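/- Let A be a finite nonempty type, r : A → ℝ, z : A → ℝ logits, π_z the softmax policy, H the entropy, J(z) = ∑_a π_z(a) · r(a), and A_z(a) = r(a) - J(z). If η > 0 and Cov_{π_z}(a ↦ log π_z(a), a ↦ π_z(a) · A_z(a)) > 0, then the Fréchet derivative of H at z applied to the direction Δ(a) = η · π_z(a) · A_z(a) is strictly negative; that is, to first order the policy gradient update strictly decreases entropy. -/

import Mathlib

/-- Softmax policy induced by logits `z`. -/
noncomputable def softmax {A : Type*} [Fintype A] (z : A → ℝ) (a : A) : ℝ :=
  Real.exp (z a) / ∑ a', Real.exp (z a')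

/-- Shannon entropy of the softmax policy. -/
noncomputable def entropy {A : Type*} [Fintype A] (z : A → ℝ) : ℝ :=
  -∑ a, softmax z a * Real.log (softmax z a)

/-- Expected reward of the softmax policy. -/
noncomputable def expReward {A : Type*} [Fintype A] (r : A → ℝ) (z : A → ℝ) : ℝ :=
  ∑ a, softmax z a * r a

/-- Advantage of action `a` under the softmax policy with logits `z`. -/
noncomputable def advantage {A : Type*} [Fintype A] (r : A → ℝ) (z : A → ℝ) (a : A) : ℝ :=
  r a - expReward r z

/-- Covariance of `f` and `g` under the probability vector `p`. -/
noncomputable def cov {A : Type*} [Fintype A] (p f g : A → ℝ) : ℝ :=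
  ∑ a, p a * (f a - ∑ a', p a' * f a') * (g a - ∑ a', p a' * g a')

theorem sum_exp_pos {A : Type*} [Fintype A] [Nonempty A] (z : A → ℝ) :
    0 < ∑ a, Real.exp (z a) :=
  Finset.sum_pos (fun a _ => Real.exp_pos (z a)) Finset.univ_nonempty

theorem softmax_pos {A : Type*} [Fintype A] [Nonempty A] (z : A → ℝ) (a : A) :
    0 < softmax z a :=
  div_pos (Real.exp_pos _) (sum_exp_pos z)

theorem sum_softmax {A : Type*} [Fintype A] [Nonempty A] (z : A → ℝ) :
    ∑ a, softmax z a = 1 := by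
  simp only [softmax, ← Finset.sum_div]
  exact div_self (sum_exp_pos z).ne'

theorem log_softmax {A : Type*} [Fintype A] [Nonempty A] (z : A → ℝ) (a : A) :
    Real.log (softmax z a) = z a - Real.log (∑ a', Real.exp (z a')) := by
  rw [softmax, Real.log_div (Real.exp_pos _).ne' (sum_exp_pos z).ne', Real.log_exp]

/-- The derivative of `z ↦ log π_z(a)`: the coordinate `a` minus the mean under `π_z`. -/
noncomputable def softmaxScore {A : Type*} [Fintype A] (z : A → ℝ) (a : A) : (A → ℝ) →L[ℝ] ℝ :=
  (ContinuousLinearMap.proj a : (A → ℝ) →L[ℝ] ℝ) -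
    ∑ b, softmax z b • (ContinuousLinearMap.proj b : (A → ℝ) →L[ℝ] ℝ)

theorem softmaxScore_apply {A : Type*} [Fintype A] (z : A → ℝ) (a : A) (v : A → ℝ) :
    softmaxScore z a v = v a - ∑ b, softmax z b * v b := by
  simp [softmaxScore, sum_apply]

theorem hasFDerivAt_log_softmax {A : Type*} [Fintype A] [Nonempty A] (z : A → ℝ) (a : A) :
    HasFDerivAt (fun w => Real.log (softmax w a)) (softmaxScore z a) z := by
  simp only [log_softmax]
  have hS : HasFDerivAt (fun w : A → ℝ => ∑ b, Real.exp (w b))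
      (∑ b, Real.exp (z b) • (ContinuousLinearMap.proj b : (A → ℝ) →L[ℝ] ℝ)) z :=
    HasFDerivAt.fun_sum fun b _ => (hasFDerivAt_apply b z).exp
  refine ((hasFDerivAt_apply a z).fun_sub (hS.log (sum_exp_pos z).ne')).congr_fderiv ?_
  simp only [softmaxScore, softmax, Finset.smul_sum, smul_smul, div_eq_inv_mul]

theorem hasFDerivAt_softmax {A : Type*} [Fintype A] [Nonempty A] (z : A → ℝ) (a : A) :
    HasFDerivAt (fun w => softmax w a) (softmax z a • softmaxScore z a) z := by
  simpa only [Real.exp_log (softmax_pos _ a)] using (hasFDerivAt_log_softmax z a).exp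

theorem sum_softmax_mul_sub_mean {A : Type*} [Fintype A] [Nonempty A] (z v : A → ℝ) :
    ∑ a, softmax z a * (v a - ∑ b, softmax z b * v b) = 0 := by
  simp only [mul_sub, Finset.sum_sub_distrib, ← Finset.sum_mul, sum_softmax, one_mul, sub_self]

theorem cov_softmax_eq {A : Type*} [Fintype A] [Nonempty A] (z f g : A → ℝ) :
    cov (softmax z) f g = ∑ a, softmax z a * f a * (g a - ∑ b, softmax z b * g b) := by
  calc cov (softmax z) f g
      = ∑ a, softmax z a * f a * (g a - ∑ b, softmax z b * g b) -
          (∑ b, softmax z b * f b) * ∑ a, softmax z a * (g a - ∑ b, softmax z b * g b) := by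
        rw [cov, Finset.mul_sum, ← Finset.sum_sub_distrib]
        exact Finset.sum_congr rfl fun a _ => by ring
    _ = _ := by rw [sum_softmax_mul_sub_mean, mul_zero, sub_zero]

theorem fderiv_entropy_apply {A : Type*} [Fintype A] [Nonempty A] (z v : A → ℝ) :
    fderiv ℝ entropy z v = -cov (softmax z) (fun a => Real.log (softmax z a)) v := by
  have h : HasFDerivAt (fun w : A → ℝ => -∑ a, softmax w a * Real.log (softmax w a)) _ z :=
    (HasFDerivAt.fun_sum fun a _ =>
      (hasFDerivAt_softmax z a).mul (hasFDerivAt_log_softmax z a)).neg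
  change fderiv ℝ (fun w : A → ℝ => -∑ a, softmax w a * Real.log (softmax w a)) z v = _
  rw [h.fderiv, cov_softmax_eq]
  simp only [neg_apply, sum_apply, add_apply, smul_apply, smul_eq_mul,
    softmaxScore_apply, Finset.sum_add_distrib, sum_softmax_mul_sub_mean, zero_add]
  exact congrArg _ (Finset.sum_congr rfl fun a _ => by ring)

/-- If the covariance between log-probabilities and `π_z · A_z` is positive and `η > 0`,
then to first order the policy-gradient update strictly decreases entropy. -/
theorem entropy_strictDecrease_of_pos_cov {A : Type*} [Fintype A] [Nonempty A]
    (r : A → ℝ) (z : A → ℝ) (η : ℝ) (hη : 0 < η)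
    (hcov : 0 < cov (softmax z) (fun a => Real.log (softmax z a))
      (fun a => softmax z a * advantage r z a)) :
    fderiv ℝ entropy z (fun a => η * (softmax z a * advantage r z a)) < 0 := by
  have hsmul : (fun a => η * (softmax z a * advantage r z a)) =
      η • fun a => softmax z a * advantage r z a := rfl
  rw [hsmul, map_smul, fderiv_entropy_apply, smul_eq_mul, mul_neg]
  exact neg_neg_of_pos (mul_pos hη hcov)
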